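/- arXiv:1801.02405 — 3 statements merged into one kernel-verified Lean document; each statement's English description precedes it below -/
import Mathlib

section
/- Every countably infinite, connected, locally finite graph whose automorphism group acts primitively on the vertex set is 2-distinguishable with density zero, i.e., it admits a distinguishing 2-coloring one of whose color classes W satisfies δ_v(W) = 0 for every vertex v. -/
open Filter SimpleGraph

/-- The ball of radius `n` around `v`: all vertices at distance at most `n` from `v`. -/
def gball {V : Type*} (G : SimpleGraph V) (v : V) (n : ℕ) : Set V :=
  {x | G.dist v x ≤ n}

/-- The sphere of radius `n` around `v`: all vertices at distance exactly `n` from `v`. -/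
def gsphere {V : Type*} (G : SimpleGraph V) (v : V) (n : ℕ) : Set V :=
  {x | G.dist v x = n}

/-- A 2-coloring (vertices colored by `Bool`) is distinguishing if the identity is the
only automorphism preserving it. -/
def Distinguishing {V : Type*} (G : SimpleGraph V) (l : V → Bool) : Prop :=
  ∀ g : G ≃g G, (∀ x, l (g x) = l x) → ∀ x, g x = x

/-- The set `W` has density zero at `v`:
`|B_v(n) ∩ W| / |B_v(n)| → 0` as `n → ∞`. -/
def DensityZeroAt {V : Type*} (G : SimpleGraph V) (W : Set V) (v : V) : Prop :=
  Tendsto (fun n : ℕ => ((gball G v n ∩ W).ncard : ℝ) / ((gball G v n).ncard : ℝ))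
    atTop (nhds 0)

/-- The automorphism group of `G` acts primitively on the vertices: it acts transitively
and the only equivalence relations on the vertex set preserved by all automorphisms are
the universal relation and equality. -/
def Primitive {V : Type*} (G : SimpleGraph V) : Prop :=
  (∀ u v : V, ∃ g : G ≃g G, g u = v) ∧
  ∀ r : Setoid V, (∀ (g : G ≃g G) (x y : V), r.r x y → r.r (g x) (g y)) →
    (∀ x y : V, r.r x y) ∨ (∀ x y : V, r.r x y → x = y)

section Distance

variable {V : Type*} {G : SimpleGraph V}

lemma iso_dist (hconn : G.Connected) (g : G ≃g G) (u v : V) :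
    G.dist (g u) (g v) = G.dist u v := by
  have key : ∀ (f : G ≃g G) (a b : V), G.dist (f a) (f b) ≤ G.dist a b := by
    intro f a b
    obtain ⟨p, hp⟩ := hconn.exists_walk_length_eq_dist a b
    rw [← hp, ← Walk.length_map f.toHom p]
    exact dist_le _
  refine le_antisymm (key g u v) ?_
  simpa using key g.symm (g u) (g v)

lemma exists_adj_dist_succ (hconn : G.Connected) {u x : V} (h : u ≠ x) :
    ∃ y, G.Adj u y ∧ G.dist y x + 1 = G.dist u x := by
  obtain ⟨p, hp⟩ := hconn.exists_walk_length_eq_dist u x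
  cases p with
  | nil => exact absurd rfl h
  | @cons _ y _ hadj q =>
    refine ⟨y, hadj, le_antisymm ?_ ?_⟩
    · rw [← hp, Walk.length_cons]
      exact Nat.succ_le_succ (dist_le q)
    · have h1 := hconn.dist_triangle (u := u) (v := y) (w := x)
      rw [dist_eq_one_iff_adj.2 hadj] at h1
      omega

lemma exists_vertex_dist_eq (hconn : G.Connected) (u : V) (n m : ℕ) (x : V)
    (hx : G.dist u x = n + m) : ∃ y, G.dist u y = n := by
  induction m generalizing x with
  | zero => exact ⟨x, hx⟩
  | succ m ih =>
    have hne : x ≠ u := by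
      rintro rfl
      simp at hx
    obtain ⟨y, -, hy⟩ := exists_adj_dist_succ hconn hne
    rw [dist_comm, dist_comm (u := x)] at hy
    exact ih y (by omega)

lemma gball_finite (hconn : G.Connected) (hlf : ∀ x : V, (G.neighborSet x).Finite)
    (v : V) (n : ℕ) : (gball G v n).Finite := by
  induction n generalizing v with
  | zero =>
    refine (Set.finite_singleton v).subset fun x hx => ?_
    have : G.dist v x = 0 := Nat.le_zero.1 hx
    exact (hconn.dist_eq_zero_iff.1 this).symm
  | succ n ih =>
    refine (((hlf v).biUnion fun y _ => ih y).union (Set.finite_singleton v)).subset ?_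
    intro x hx
    by_cases h : v = x
    · exact Or.inr h.symm
    · obtain ⟨y, hy, hd⟩ := exists_adj_dist_succ hconn h
      refine Or.inl (Set.mem_biUnion (show y ∈ G.neighborSet v from hy) ?_)
      have : G.dist v x ≤ n + 1 := hx
      show G.dist y x ≤ n
      omega

variable [Infinite V]

lemma exists_lt_dist (hconn : G.Connected) (hlf : ∀ x : V, (G.neighborSet x).Finite)
    (v : V) (n : ℕ) : ∃ x, n < G.dist v x := by
  obtain ⟨x, hx⟩ := (gball_finite hconn hlf v n).exists_notMem
  exact ⟨x, not_le.1 hx⟩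

lemma succ_le_ncard_gball (hconn : G.Connected) (hlf : ∀ x : V, (G.neighborSet x).Finite)
    (v : V) (n : ℕ) : n + 1 ≤ (gball G v n).ncard := by
  induction n with
  | zero =>
    exact (Set.ncard_pos (gball_finite hconn hlf v 0)).2 ⟨v, by simp [gball]⟩
  | succ n ih =>
    refine Nat.succ_le_of_lt (ih.trans_lt ?_)
    refine Set.ncard_lt_ncard ⟨fun x hx => Nat.le_succ_of_le hx, fun h => ?_⟩
      (gball_finite hconn hlf v (n + 1))
    obtain ⟨x, hx⟩ := exists_lt_dist hconn hlf v (n + 1)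
    obtain ⟨y, hy⟩ := exists_vertex_dist_eq hconn v (n + 1) (G.dist v x - (n + 1)) x (by omega)
    have : G.dist v y ≤ n := h (show G.dist v y ≤ n + 1 from hy.le)
    omega

end Distance

section Spheres

variable {V : Type*} [Infinite V] {G : SimpleGraph V}

/-- In a primitive graph, two vertices all of whose large spheres coincide are equal. -/
lemma eq_of_eventually_gsphere_eq (hconn : G.Connected)
    (hlf : ∀ x : V, (G.neighborSet x).Finite) (hprim : Primitive G) {u w : V} {N : ℕ}
    (h : ∀ n ≥ N, gsphere G u n = gsphere G w n) : u = w := by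
  let r : Setoid V :=
    { r := fun a b => ∃ N, ∀ n ≥ N, gsphere G a n = gsphere G b n
      iseqv :=
        { refl := fun a => ⟨0, fun _ _ => rfl⟩
          symm := fun ⟨N, hN⟩ => ⟨N, fun n hn => (hN n hn).symm⟩
          trans := fun ⟨N, hN⟩ ⟨M, hM⟩ => ⟨max N M, fun n hn =>
            (hN n (le_of_max_le_left hn)).trans (hM n (le_of_max_le_right hn))⟩ } }
  have hinv : ∀ (g : G ≃g G) (x y : V), r.r x y → r.r (g x) (g y) := by
    rintro g x y ⟨N, hN⟩
    refine ⟨N, fun n hn => Set.ext fun z => ?_⟩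
    have h1 := Set.ext_iff.1 (hN n hn) (g.symm z)
    simp only [gsphere, Set.mem_ofPred_eq] at h1 ⊢
    rw [← iso_dist hconn g, ← iso_dist hconn g y] at h1
    simpa using h1
  rcases hprim.2 r hinv with hall | htriv
  · exfalso
    choose M hM using fun y => hall u y
    obtain ⟨K, hK⟩ := ((hlf u).image M).bddAbove
    obtain ⟨x, hx⟩ := exists_lt_dist hconn hlf u K
    have hne : u ≠ x := by
      rintro rfl
      simp at hx
    obtain ⟨y, hy, hd⟩ := exists_adj_dist_succ hconn hne
    have hMy : M y ≤ K := hK ⟨y, hy, rfl⟩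
    have hmem : x ∈ gsphere G y (G.dist y x) := rfl
    rw [← hM y (G.dist y x) (by omega)] at hmem
    have : G.dist u x = G.dist y x := hmem
    omega
  · exact htriv u w ⟨N, h⟩

lemma exists_far_dist_ne (hconn : G.Connected) (hlf : ∀ x : V, (G.neighborSet x).Finite)
    (hprim : Primitive G) (v u w : V) (N : ℕ) :
    ∃ x, N ≤ G.dist v x ∧ (u ≠ w → G.dist u x ≠ G.dist w x) := by
  by_cases huw : u = w
  · obtain ⟨x, hx⟩ := exists_lt_dist hconn hlf v N
    exact ⟨x, hx.le, fun h => absurd huw h⟩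
  · by_contra! hcon
    refine huw (eq_of_eventually_gsphere_eq hconn hlf hprim
      (N := N + G.dist v u + G.dist v w) fun n hn => Set.ext fun x => ?_)
    have h1 := hconn.dist_triangle (u := u) (v := v) (w := x)
    have h2 := hconn.dist_triangle (u := w) (v := v) (w := x)
    rw [dist_comm (u := u) (v := v)] at h1
    rw [dist_comm (u := w) (v := v)] at h2
    simp only [gsphere, Set.mem_ofPred_eq]
    constructor
    · intro hx
      rw [← (hcon x (by omega)).2, hx]
    · intro hx
      rw [(hcon x (by omega)).2, hx]

lemma exists_sparse_separating_seq [Countable V] (hconn : G.Connected)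
    (hlf : ∀ x : V, (G.neighborSet x).Finite) (hprim : Primitive G) (v : V) :
    ∃ s : ℕ → V, (∀ k, G.dist v (s k) + 2 ≤ G.dist v (s (k + 1))) ∧
      (∀ k, k ^ 2 + 3 ≤ G.dist v (s k)) ∧
      ∀ u w, u ≠ w → ∃ k, G.dist u (s k) ≠ G.dist w (s k) := by
  choose f hf hf' using exists_far_dist_ne hconn hlf hprim v
  obtain ⟨p, hp⟩ := exists_surjective_nat (V × V)
  let s : ℕ → V := fun k => Nat.rec (f (p 0).1 (p 0).2 3)
    (fun k y => f (p (k + 1)).1 (p (k + 1)).2 (G.dist v y + 2 * k + 2)) k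
  have hstep : ∀ k, G.dist v (s k) + 2 * k + 2 ≤ G.dist v (s (k + 1)) :=
    fun k => hf _ _ _
  refine ⟨s, fun k => by have := hstep k; omega, fun k => ?_, fun u w huw => ?_⟩
  · induction k with
    | zero => exact hf _ _ _
    | succ k ih => nlinarith [hstep k]
  · obtain ⟨k, hk⟩ := hp (u, w)
    refine ⟨k, ?_⟩
    have h1 : (p k).1 = u := by rw [hk]
    have h2 : (p k).2 = w := by rw [hk]
    have : G.dist (p k).1 (s k) ≠ G.dist (p k).2 (s k) := by
      cases k with
      | zero => exact hf' _ _ _ (by rwa [h1, h2])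
      | succ k => exact hf' _ _ _ (by rwa [h1, h2])
    rwa [h1, h2] at this

end Spheres

section Coloring

variable {V : Type*} [Infinite V] {G : SimpleGraph V}

lemma densityZeroAt_of_sparse (hconn : G.Connected)
    (hlf : ∀ x : V, (G.neighborSet x).Finite) {v : V} {s : ℕ → V}
    (hs : ∀ k, k ^ 2 ≤ G.dist v (s k)) {F : Set V} (hF : F.Finite) (u : V) :
    DensityZeroAt G (F ∪ Set.range s) u := by
  set d := G.dist v u
  have hcard : ∀ n, (gball G u n ∩ (F ∪ Set.range s)).ncard ≤
      F.ncard + (Nat.sqrt (d + n) + 1) := by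
    intro n
    have hsub : gball G u n ∩ (F ∪ Set.range s) ⊆
        F ∪ s '' (Finset.range (Nat.sqrt (d + n) + 1) : Finset ℕ) := by
      rintro x ⟨hx, hxF | ⟨k, rfl⟩⟩
      · exact Or.inl hxF
      · refine Or.inr ⟨k, ?_, rfl⟩
        have h1 : G.dist u (s k) ≤ n := hx
        have h2 := hconn.dist_triangle (u := v) (v := u) (w := s k)
        have h3 := hs k
        simp only [Finset.coe_range, Set.mem_Iio, Nat.lt_succ_iff]
        exact Nat.le_sqrt'.2 (by omega)
    refine (Set.ncard_le_ncard hsub (hF.union ((Finset.finite_toSet _).image s))).trans ?_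
    refine (Set.ncard_union_le _ _).trans (Nat.add_le_add_left ?_ _)
    refine (Set.ncard_image_le (Finset.finite_toSet _)).trans ?_
    rw [Set.ncard_coe_finset, Finset.card_range]
  have hbound : ∀ n : ℕ, ((gball G u n ∩ (F ∪ Set.range s)).ncard : ℝ) /
      ((gball G u n).ncard : ℝ) ≤ ((F.ncard : ℝ) + √d + 2) / √((n : ℝ) + 1) := by
    intro n
    have hpos : (0 : ℝ) < (n : ℝ) + 1 := by positivity
    have hsq1 : (1 : ℝ) ≤ √((n : ℝ) + 1) := by
      rw [Real.one_le_sqrt]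
      linarith [Nat.cast_nonneg (α := ℝ) n]
    have hnum : ((gball G u n ∩ (F ∪ Set.range s)).ncard : ℝ) ≤
        ((F.ncard : ℝ) + √d + 2) * √((n : ℝ) + 1) := by
      have h1 : ((gball G u n ∩ (F ∪ Set.range s)).ncard : ℝ) ≤
          (F.ncard : ℝ) + ((Nat.sqrt (d + n) : ℝ) + 1) := by exact_mod_cast hcard n
      have h2 : (Nat.sqrt (d + n) : ℝ) ≤ √((d : ℝ) + n) := by
        have := Real.nat_sqrt_le_real_sqrt (a := d + n)
        push_cast at this
        exact this
      have h3 : √((d : ℝ) + n) ≤ √d + √((n : ℝ) + 1) := by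
        refine Real.sqrt_le_iff.2 ⟨by positivity, ?_⟩
        nlinarith [Real.sq_sqrt (Nat.cast_nonneg (α := ℝ) d), Real.sq_sqrt hpos.le,
          mul_nonneg (Real.sqrt_nonneg (d : ℝ)) (Real.sqrt_nonneg ((n : ℝ) + 1))]
      have h4 : 0 ≤ ((F.ncard : ℝ) + √d + 1) * (√((n : ℝ) + 1) - 1) :=
        mul_nonneg (by positivity) (by linarith)
      linarith
    have hden : (n : ℝ) + 1 ≤ ((gball G u n).ncard : ℝ) := by
      exact_mod_cast succ_le_ncard_gball hconn hlf u n
    have hsq : √((n : ℝ) + 1) * √((n : ℝ) + 1) = (n : ℝ) + 1 := Real.mul_self_sqrt hpos.le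
    rw [div_le_div_iff₀ (by linarith) (by linarith)]
    calc _ ≤ ((F.ncard : ℝ) + √d + 2) * √((n : ℝ) + 1) * √((n : ℝ) + 1) := by gcongr
      _ = ((F.ncard : ℝ) + √d + 2) * ((n : ℝ) + 1) := by rw [mul_assoc, hsq]
      _ ≤ _ := by gcongr
  refine squeeze_zero (fun n => by positivity) hbound ?_
  refine Tendsto.div_atTop tendsto_const_nhds ?_
  exact Real.tendsto_sqrt_atTop.comp
    (tendsto_atTop_add_const_right _ _ tendsto_natCast_atTop_atTop)

/-- An automorphism preserving the closed neighbourhood of `v` together with a set of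
pairwise non-adjacent vertices far from `v` fixes `v`. -/
lemma iso_fixes_center (hconn : G.Connected) (hlf : ∀ x : V, (G.neighborSet x).Finite)
    (hprim : Primitive G) {v : V} {S : Set V} (hfar : ∀ x ∈ S, 3 ≤ G.dist v x)
    (hind : ∀ x ∈ S, ∀ y ∈ S, ¬ G.Adj x y) (g : G ≃g G)
    (hg : ∀ x, x ∈ gball G v 1 ∪ S → g x ∈ gball G v 1 ∪ S) : g v = v := by
  have hnb : ∀ y, G.dist (g v) y ≤ 1 → y ∈ gball G v 1 ∪ S := by
    intro y hy
    rw [← g.apply_symm_apply y] at hy ⊢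
    rw [iso_dist hconn] at hy
    exact hg _ (Or.inl hy)
  rcases hnb (g v) (by simp) with hball | hS
  · have hsub : gball G (g v) 1 ⊆ gball G v 1 := by
      intro y hy
      rcases hnb y hy with h | h
      · exact h
      · have h1 := hfar y h
        have h2 := hconn.dist_triangle (u := v) (v := g v) (w := y)
        have h3 : G.dist v (g v) ≤ 1 := hball
        have h4 : G.dist (g v) y ≤ 1 := hy
        omega
    have himage : g '' gball G v 1 = gball G (g v) 1 := by
      ext y
      constructor
      · rintro ⟨x, hx, rfl⟩
        show G.dist (g v) (g x) ≤ 1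
        rwa [iso_dist hconn]
      · intro hy
        refine ⟨g.symm y, ?_, g.apply_symm_apply y⟩
        show G.dist v (g.symm y) ≤ 1
        rwa [← iso_dist hconn g, g.apply_symm_apply]
    have heq : gball G (g v) 1 = gball G v 1 := by
      refine Set.eq_of_subset_of_ncard_le hsub ?_ (gball_finite hconn hlf v 1)
      rw [← himage, Set.ncard_image_of_injective _ g.injective]
    have hle : ∀ a b : V, gball G a 1 = gball G b 1 → ∀ x, 2 ≤ G.dist a x →
        G.dist b x ≤ G.dist a x := by
      intro a b hab x hx
      have hne : a ≠ x := by
        rintro rfl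
        simp at hx
      obtain ⟨y, hy, hd⟩ := exists_adj_dist_succ hconn hne
      have hyb : y ∈ gball G b 1 := by
        rw [← hab]
        exact (dist_eq_one_iff_adj.2 hy).le
      have h1 : G.dist b y ≤ 1 := hyb
      have h2 := hconn.dist_triangle (u := b) (v := y) (w := x)
      omega
    have hsmall : ∀ a b : V, gball G a 1 = gball G b 1 → ∀ x, 2 ≤ G.dist a x →
        2 ≤ G.dist b x := by
      intro a b hab x hx
      by_contra! h
      have : x ∈ gball G a 1 := by
        rw [hab]
        exact Nat.lt_succ_iff.1 h
      have : G.dist a x ≤ 1 := this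
      omega
    have hdist : ∀ a b : V, gball G a 1 = gball G b 1 → ∀ x, 2 ≤ G.dist a x →
        G.dist b x = G.dist a x := fun a b hab x hx =>
      le_antisymm (hle a b hab x hx) (hle b a hab.symm x (hsmall a b hab x hx))
    refine eq_of_eventually_gsphere_eq hconn hlf hprim (N := 2) fun n hn => Set.ext fun x => ?_
    constructor
    · intro hx
      have hx : G.dist (g v) x = n := hx
      exact (hdist _ _ heq x (by omega)).trans hx
    · intro hx
      have hx : G.dist v x = n := hx
      exact (hdist _ _ heq.symm x (by omega)).trans hx
  · exfalso
    obtain ⟨x, hx⟩ := exists_ne (g v)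
    obtain ⟨y, hy, -⟩ := exists_adj_dist_succ hconn hx.symm
    rcases hnb y (dist_eq_one_iff_adj.2 hy).le with h | h
    · have h1 := hfar _ hS
      have h2 := hconn.dist_triangle (u := v) (v := y) (w := g v)
      have h3 : G.dist v y ≤ 1 := h
      rw [dist_eq_one_iff_adj.2 hy.symm] at h2
      omega
    · exact hind _ hS _ h hy

end Coloring

/-- Every countably infinite, connected, locally finite graph whose
automorphism group acts primitively on the vertex set is 2-distinguishable with
density zero. -/
theorem stmt_3 {V : Type*} [Countable V] [Infinite V] (G : SimpleGraph V)
    (hconn : G.Connected) (hlf : ∀ x : V, (G.neighborSet x).Finite)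
    (hprim : Primitive G) :
    ∃ l : V → Bool, Distinguishing G l ∧
      ∃ b : Bool, ∀ u : V, DensityZeroAt G {x | l x = b} u := by
  classical
  obtain ⟨v⟩ := hconn.nonempty
  obtain ⟨s, hgap, hsq, hsep⟩ := exists_sparse_separating_seq hconn hlf hprim v
  have hmono : StrictMono fun k => G.dist v (s k) :=
    strictMono_nat_of_lt_succ fun k => by have := hgap k; omega
  have hgap' : ∀ i j, i < j → G.dist v (s i) + 2 ≤ G.dist v (s j) := fun i j hij =>
    (hgap i).trans (hmono.monotone (Nat.succ_le_of_lt hij))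
  have hfar : ∀ x ∈ Set.range s, 3 ≤ G.dist v x := by
    rintro _ ⟨k, rfl⟩
    exact le_trans (Nat.le_add_left _ _) (hsq k)
  have hnonadj : ∀ i j, i < j → ¬ G.Adj (s i) (s j) := by
    intro i j hij hadj
    have h1 := hconn.dist_triangle (u := v) (v := s i) (w := s j)
    rw [dist_eq_one_iff_adj.2 hadj] at h1
    have := hgap' i j hij
    omega
  have hind : ∀ x ∈ Set.range s, ∀ y ∈ Set.range s, ¬ G.Adj x y := by
    rintro _ ⟨i, rfl⟩ _ ⟨j, rfl⟩ hadj
    rcases lt_trichotomy i j with h | rfl | h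
    · exact hnonadj i j h hadj
    · exact hadj.ne rfl
    · exact hnonadj j i h hadj.symm
  refine ⟨fun x => decide (x ∈ gball G v 1 ∪ Set.range s), ?_, true, fun u => ?_⟩
  · intro g hg
    have hg' : ∀ x, g x ∈ gball G v 1 ∪ Set.range s ↔ x ∈ gball G v 1 ∪ Set.range s :=
      fun x => decide_eq_decide.1 (hg x)
    have hv : g v = v :=
      iso_fixes_center hconn hlf hprim hfar hind g fun x => (hg' x).2
    have hs : ∀ k, g (s k) = s k := by
      intro k
      have hd : G.dist v (g (s k)) = G.dist v (s k) := by
        conv_lhs => rw [← hv]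
        exact iso_dist hconn g v (s k)
      rcases (hg' (s k)).2 (Or.inr ⟨k, rfl⟩) with h | ⟨j, hj⟩
      · have h1 : G.dist v (g (s k)) ≤ 1 := h
        have h2 := hfar (s k) ⟨k, rfl⟩
        omega
      · rw [← hj] at hd ⊢
        rw [hmono.injective hd]
    intro x
    by_contra hne
    obtain ⟨k, hk⟩ := hsep _ _ hne
    refine hk ?_
    conv_lhs => rw [← hs k]
    exact iso_dist hconn g x (s k)
  · simp only [decide_eq_true_eq, Set.ofPred_mem_eq]
    exact densityZeroAt_of_sparse hconn hlf
      (fun k => le_trans (Nat.le_add_right _ _) (hsq k)) (gball_finite hconn hlf v 1) u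
end

section
/- The Cartesian (box) product of any two connected, countably infinite graphs each of infinite diameter is 2-distinguishable with density zero, i.e., it admits a distinguishing 2-coloring one of whose color classes W satisfies δ_v(W) = 0 for every vertex v. -/
open Filter SimpleGraph

namespace SimpleGraph

variable {V W : Type*}

lemma dist_boxProd {G : SimpleGraph V} {H : SimpleGraph W} (hG : G.Connected)
    (hH : H.Connected) (x y : V × W) :
    (G.boxProd H).dist x y = G.dist x.1 y.1 + H.dist x.2 y.2 := by
  have hx := (edist_ne_top_iff_reachable (G := G)).2 (hG x.1 y.1)
  have hy := (edist_ne_top_iff_reachable (G := H)).2 (hH x.2 y.2)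
  unfold dist
  rw [edist_boxProd, ENat.toNat_add hx hy]

lemma Connected.dist_map_le {G : SimpleGraph V} {H : SimpleGraph W} (hG : G.Connected)
    (f : G →g H) (x y : V) : H.dist (f x) (f y) ≤ G.dist x y := by
  obtain ⟨p, hp⟩ := hG.exists_walk_length_eq_dist x y
  rw [← hp, ← Walk.length_map f p]
  exact dist_le _

lemma Connected.dist_iso {G : SimpleGraph V} (hG : G.Connected) (f : G ≃g G) (x y : V) :
    G.dist (f x) (f y) = G.dist x y := by
  refine le_antisymm (hG.dist_map_le f.toHom x y) ?_
  simpa using hG.dist_map_le f.symm.toHom (f x) (f y)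

lemma Connected.exists_dist_eq {G : SimpleGraph V} (hG : G.Connected) {u v : V} {k : ℕ}
    (hk : k ≤ G.dist u v) : ∃ x, G.dist u x = k := by
  obtain ⟨p, hp⟩ := hG.exists_walk_length_eq_dist u v
  refine ⟨p.getVert k, ?_⟩
  have h₁ := dist_le (p.take k)
  have h₂ := dist_le (p.drop k)
  have h₃ := hG.dist_triangle (u := u) (v := p.getVert k) (w := v)
  rw [Walk.take_length] at h₁
  rw [Walk.drop_length] at h₂
  omega

/-- In a connected graph of infinite diameter, every vertex has infinite eccentricity. -/
lemma Connected.exists_le_dist {G : SimpleGraph V} (hG : G.Connected)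
    (h : ∀ n : ℕ, ∃ u v : V, n ≤ G.dist u v) (u : V) (n : ℕ) : ∃ v, n ≤ G.dist u v := by
  obtain ⟨a, b, hab⟩ := h (2 * n)
  have ht := hG.dist_triangle (u := a) (v := u) (w := b)
  rw [G.dist_comm (u := a) (v := u)] at ht
  by_cases ha : n ≤ G.dist u a
  · exact ⟨a, ha⟩
  · exact ⟨b, by omega⟩

lemma Connected.succ_le_ncard_gball {G : SimpleGraph V} (hG : G.Connected) {u : V}
    (h : ∀ n : ℕ, ∃ v, n ≤ G.dist u v) {n : ℕ} (hfin : (gball G u n).Finite) :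
    n + 1 ≤ (gball G u n).ncard := by
  have hsub : (Finset.range (n + 1) : Set ℕ) ⊆ G.dist u '' gball G u n := by
    intro k hk
    obtain ⟨v, hv⟩ := h k
    obtain ⟨x, hx⟩ := hG.exists_dist_eq hv
    refine ⟨x, ?_, hx⟩
    simp only [Finset.coe_range, Set.mem_Iio] at hk
    simp only [gball, Set.mem_ofPred_eq]
    omega
  have h₁ := Set.ncard_le_ncard hsub (hfin.image _)
  rw [Set.ncard_coe_finset, Finset.card_range] at h₁
  exact h₁.trans (Set.ncard_image_le hfin)

/-- The range of a sequence escaping quadratically fast from a vertex has density zero. -/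
lemma Connected.densityZeroAt_range {G : SimpleGraph V} (hG : G.Connected)
    (h : ∀ n : ℕ, ∃ u v : V, n ≤ G.dist u v) {v : V} {w : ℕ → V}
    (hw : ∀ i, i * i ≤ G.dist v (w i)) (u : V) : DensityZeroAt G (Set.range w) u := by
  set c := G.dist v u
  have hcard (n : ℕ) : (gball G u n ∩ Set.range w).ncard ≤ Nat.sqrt (n + c) + 1 := by
    have hsub : gball G u n ∩ Set.range w ⊆
        ((Finset.range (Nat.sqrt (n + c) + 1) : Finset ℕ) : Set ℕ).image w := by
      rintro _ ⟨hx, i, rfl⟩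
      refine ⟨i, ?_, rfl⟩
      have ht := hG.dist_triangle (u := v) (v := u) (w := w i)
      have hi := hw i
      simp only [gball, Set.mem_ofPred_eq] at hx
      simp only [Finset.coe_range, Set.mem_Iio, Nat.lt_succ_iff]
      rw [Nat.le_sqrt]
      omega
    refine (Set.ncard_le_ncard hsub ((Finset.finite_toSet _).image _)).trans ?_
    refine (Set.ncard_image_le (Finset.finite_toSet _)).trans ?_
    rw [Set.ncard_coe_finset, Finset.card_range]
  have hbound (n : ℕ) :
      ((gball G u n ∩ Set.range w).ncard : ℝ) / ((gball G u n).ncard : ℝ) ≤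
        (Real.sqrt (c + 1) + 1) / Real.sqrt (n + 1) := by
    have hs : 0 < Real.sqrt ((n : ℝ) + 1) := Real.sqrt_pos.2 (by positivity)
    by_cases hfin : (gball G u n).Finite
    · have hb : ((n : ℝ) + 1) ≤ (gball G u n).ncard := by
        exact_mod_cast hG.succ_le_ncard_gball (hG.exists_le_dist h u) hfin
      have ha : ((gball G u n ∩ Set.range w).ncard : ℝ) ≤
          (Real.sqrt (c + 1) + 1) * Real.sqrt (n + 1) := by
        have h₁ : ((gball G u n ∩ Set.range w).ncard : ℝ) ≤ (Nat.sqrt (n + c) : ℝ) + 1 := by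
          exact_mod_cast hcard n
        have h₂ : (Nat.sqrt (n + c) : ℝ) ≤ Real.sqrt ((c + 1) * (n + 1)) := by
          refine Real.nat_sqrt_le_real_sqrt.trans (Real.sqrt_le_sqrt ?_)
          push_cast
          nlinarith [mul_nonneg (Nat.cast_nonneg (α := ℝ) c) (Nat.cast_nonneg (α := ℝ) n)]
        have h₃ : 1 ≤ Real.sqrt ((n : ℝ) + 1) := Real.one_le_sqrt.2 (by simp)
        rw [Real.sqrt_mul (by positivity)] at h₂
        linarith
      rw [div_le_div_iff₀ (by linarith [n.cast_nonneg (α := ℝ)]) hs]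
      calc _ ≤ (Real.sqrt (c + 1) + 1) * Real.sqrt (n + 1) * Real.sqrt (n + 1) := by gcongr
        _ = (Real.sqrt (c + 1) + 1) * (n + 1) := by
          rw [mul_assoc, Real.mul_self_sqrt (by positivity)]
        _ ≤ _ := by gcongr
    · rw [Set.Infinite.ncard hfin]
      simp only [Nat.cast_zero, div_zero]
      positivity
  refine squeeze_zero (fun n => by positivity) hbound ?_
  refine Tendsto.div_atTop tendsto_const_nhds ?_
  exact Real.tendsto_sqrt_atTop.comp
    (tendsto_atTop_add_const_right _ _ tendsto_natCast_atTop_atTop)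

/-- If any two distinct vertices are resolved by vertices arbitrarily far away, then the graph is
2-distinguishable with density zero. -/
theorem Connected.exists_distinguishing_densityZero [Countable V] {G : SimpleGraph V}
    (hG : G.Connected) (v : V) (hV : ∀ R : ℕ, ∀ x y : V,
      ∃ w, R < G.dist v w ∧ (x ≠ y → G.dist x w ≠ G.dist y w)) :
    ∃ l : V → Bool, Distinguishing G l ∧
      ∃ b : Bool, ∀ u : V, DensityZeroAt G {x | l x = b} u := by
  have : Nonempty V := ⟨v⟩
  choose F hF hFres using hV
  obtain ⟨e, he⟩ := exists_surjective_nat (V × V)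
  let w : ℕ → V := fun n => Nat.rec v
    (fun i x => F (3 * G.dist v x + (i + 1) * (i + 1)) (e (i - 1)).1 (e (i - 1)).2) n
  set D : ℕ → ℕ := fun i => G.dist v (w i)
  have hstep (i : ℕ) : 3 * D i + (i + 1) * (i + 1) < D (i + 1) := hF _ _ _
  have hmono : StrictMono D := strictMono_nat_of_lt_succ fun i => by
    have := hstep i
    omega
  have hgap {i j : ℕ} (hij : i < j) (hj : 2 ≤ j) : D i + 2 * D 1 < D j := by
    obtain ⟨k, rfl⟩ : ∃ k, j = k + 1 := ⟨j - 1, by omega⟩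
    have h₁ := hstep k
    have h₂ := hmono.monotone (show i ≤ k by omega)
    have h₃ := hmono.monotone (show 1 ≤ k by omega)
    omega
  have hsq (i : ℕ) : i * i ≤ D i := by
    cases i with
    | zero => simp
    | succ i => have := hstep i; omega
  have hinj : Function.Injective w := fun i j hij => hmono.injective (congrArg (G.dist v) hij)
  have htri₁ (i j : ℕ) : D j ≤ D i + G.dist (w i) (w j) := hG.dist_triangle
  classical
  refine ⟨fun x => decide (x ∈ Set.range w), ?_, true, fun u => ?_⟩
  · intro f hf
    have hfw (i : ℕ) : ∃ j, w j = f (w i) := by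
      have := hf (w i)
      simpa using this
    choose s hs using hfw
    have hsinj : Function.Injective s := fun i j hij =>
      hinj (f.injective (by rw [← hs, ← hs, hij]))
    have hsd (i j : ℕ) : G.dist (w (s i)) (w (s j)) = G.dist (w i) (w j) := by
      rw [hs, hs, hG.dist_iso]
    have hclose {a b : ℕ} (hab : a ≠ b) (hd : G.dist (w a) (w b) = D 1) : a < 2 ∧ b < 2 := by
      have h₁ := htri₁ a b
      have h₂ := htri₁ b a
      rw [G.dist_comm, hd] at h₂
      rw [hd] at h₁
      by_contra hcon
      rcases lt_or_gt_of_ne hab with h | h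
      · have := hgap h (by omega)
        omega
      · have := hgap h (by omega)
        omega
    obtain ⟨hs0, hs1⟩ := hclose (hsinj.ne (show (0 : ℕ) ≠ 1 by simp)) (hsd 0 1)
    have hfix (j : ℕ) (hj : 2 ≤ j) : s j = j := by
      have hsj : 2 ≤ s j := by
        have h₀ := hsinj.ne (show j ≠ 0 by omega)
        have h₁ := hsinj.ne (show j ≠ 1 by omega)
        have h₂ := hsinj.ne (show (0 : ℕ) ≠ 1 by simp)
        omega
      have hd : G.dist (w (s 0)) (w (s j)) = D j := hsd 0 j
      have h₁ := htri₁ (s 0) (s j)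
      have h₂ := hG.dist_triangle (u := w (s 0)) (v := v) (w := w (s j))
      rw [G.dist_comm (u := w (s 0)) (v := v)] at h₂
      have h₃ : D (s 0) ≤ D 1 := hmono.monotone (show s 0 ≤ 1 by omega)
      change _ ≤ D (s 0) + D (s j) at h₂
      rw [hd] at h₁ h₂
      by_contra hne
      rcases lt_or_gt_of_ne hne with h | h
      · have := hgap h hj
        omega
      · have := hgap h hsj
        omega
    intro x
    by_contra hx
    obtain ⟨i, hi⟩ := he (f x, x)
    have hres : G.dist (f x) (w (i + 2)) ≠ G.dist x (w (i + 2)) := by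
      have h := hFres (3 * D (i + 1) + (i + 1 + 1) * (i + 1 + 1)) (e (i + 1 - 1)).1
        (e (i + 1 - 1)).2
      change _ → G.dist _ (w (i + 2)) ≠ G.dist _ (w (i + 2)) at h
      rw [Nat.add_sub_cancel, hi] at h
      exact h hx
    apply hres
    have hfw : f (w (i + 2)) = w (i + 2) :=
      (hs (i + 2)).symm.trans (congrArg w (hfix (i + 2) (by omega)))
    rw [← hG.dist_iso f x, hfw]
  · have hset : {x | decide (x ∈ Set.range w) = true} = Set.range w := by
      ext x
      simp
    rw [hset]
    refine hG.densityZeroAt_range (fun n => ⟨v, F n v v, (hF n v v).le⟩) hsq u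

/-- Distinct vertices have distance functions that do not differ by a constant. -/
lemma exists_dist_add_ne {G : SimpleGraph V} (hG : G.Connected) {a a' : V} (h : a ≠ a')
    (m n : ℕ) : ∃ p, G.dist a p + m ≠ G.dist a' p + n := by
  have hpos := hG.pos_dist_of_ne h
  by_contra! hcon
  have h₁ := hcon a
  have h₂ := hcon a'
  rw [dist_self] at h₁ h₂
  rw [G.dist_comm] at h₁
  omega

end SimpleGraph

/-- The Cartesian (box) product of any two connected, countably
infinite graphs each of infinite diameter is 2-distinguishable with density zero. -/
theorem stmt_6 {V W : Type*} [Countable V] [Infinite V] [Countable W] [Infinite W]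
    (G : SimpleGraph V) (H : SimpleGraph W)
    (hG : G.Connected) (hH : H.Connected)
    (hGdiam : ∀ n : ℕ, ∃ u v : V, n ≤ G.dist u v)
    (hHdiam : ∀ n : ℕ, ∃ u v : W, n ≤ H.dist u v) :
    ∃ l : V × W → Bool, Distinguishing (G.boxProd H) l ∧
      ∃ b : Bool, ∀ u : V × W, DensityZeroAt (G.boxProd H) {x | l x = b} u := by
  obtain ⟨a₀⟩ := hG.nonempty
  obtain ⟨b₀⟩ := hH.nonempty
  refine (hG.boxProd hH).exists_distinguishing_densityZero (a₀, b₀) ?_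
  rintro R ⟨a, b⟩ ⟨a', b'⟩
  simp only [dist_boxProd hG hH]
  by_cases ha : a = a'
  · obtain ⟨p, hp⟩ := hG.exists_le_dist hGdiam a₀ (R + 1)
    by_cases hb : b = b'
    · exact ⟨(p, b₀), by simp only; omega, fun h => absurd (Prod.ext ha hb) h⟩
    · obtain ⟨q, hq⟩ := exists_dist_add_ne hH hb (G.dist a p) (G.dist a' p)
      exact ⟨(p, q), by simp only; omega, fun _ => by simp only; omega⟩
  · obtain ⟨q, hq⟩ := hH.exists_le_dist hHdiam b₀ (R + 1)
    obtain ⟨p, hp⟩ := exists_dist_add_ne hG ha (H.dist b q) (H.dist b' q)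
    exact ⟨(p, q), by simp only; omega, fun _ => hp⟩
end

section
/- Let G be a connected, locally finite graph with infinite motion, let v be a vertex and n ∈ ℕ. If g is an automorphism of G with g(v) = v that fixes every vertex of the sphere S_v(n) pointwise, then g fixes every vertex of the ball B_v(n) pointwise. -/
open Filter SimpleGraph

/-- A graph has infinite motion if every nontrivial automorphism moves infinitely many
vertices. -/
def InfiniteMotion {V : Type*} (G : SimpleGraph V) : Prop :=
  ∀ g : G ≃g G, (∃ x, g x ≠ x) → {x : V | g x ≠ x}.Infinite

theorem finite_gball {V : Type*} {G : SimpleGraph V} (hconn : G.Connected)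
    (hlf : ∀ x : V, (G.neighborSet x).Finite) (v : V) (n : ℕ) : (gball G v n).Finite := by
  induction n with
  | zero =>
    refine (Set.finite_singleton v).subset fun x hx => ?_
    exact (hconn.dist_eq_zero_iff.1 (Nat.le_zero.1 hx)).symm
  | succ n ih =>
    refine ((Set.finite_singleton v).union (ih.biUnion fun y _ => hlf y)).subset fun x hx => ?_
    obtain ⟨p, hp⟩ := hconn.exists_walk_length_eq_dist x v
    have hlen : p.length ≤ n + 1 := by
      rw [hp, dist_comm]
      exact hx
    cases p with
    | nil => exact Or.inl rfl
    | @cons _ y _ hadj q =>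
      refine Or.inr (Set.mem_biUnion (x := y) ?_ hadj.symm)
      rw [Walk.length_cons] at hlen
      change G.dist v y ≤ n
      rw [dist_comm]
      exact (dist_le q).trans (by omega)

theorem dist_apply_le {V : Type*} {G : SimpleGraph V} (hconn : G.Connected) (g : G ≃g G)
    (x y : V) : G.dist (g x) (g y) ≤ G.dist x y := by
  obtain ⟨p, hp⟩ := hconn.exists_walk_length_eq_dist x y
  rw [← hp, ← Walk.length_map g.toHom p]
  exact dist_le _

theorem dist_apply_eq {V : Type*} {G : SimpleGraph V} (hconn : G.Connected) (g : G ≃g G)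
    (x y : V) : G.dist (g x) (g y) = G.dist x y :=
  (dist_apply_le hconn g x y).antisymm <| by
    simpa using dist_apply_le hconn g.symm (g x) (g y)

/-- An automorphism fixing the centre and the sphere can be replaced by the identity outside
the ball. -/
theorem exists_iso_eq_on_gball {V : Type*} {G : SimpleGraph V} (hconn : G.Connected)
    (v : V) (n : ℕ) (g : G ≃g G) (hgv : g v = v) (hsph : ∀ x ∈ gsphere G v n, g x = x) :
    ∃ h : G ≃g G, (∀ x ∈ gball G v n, h x = g x) ∧ ∀ x ∉ gball G v n, h x = x := by
  classical
  have hinv : ∀ x, g.toEquiv x ∈ gball G v n ↔ x ∈ gball G v n := fun x => by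
    change G.dist v (g x) ≤ n ↔ G.dist v x ≤ n
    conv_lhs => rw [← hgv, dist_apply_eq hconn]
  let e : Equiv.Perm V := Equiv.Perm.ofSubtype (Equiv.Perm.subtypePerm g.toEquiv hinv)
  have hin : ∀ x ∈ gball G v n, e x = g x := fun x hx =>
    Equiv.Perm.ofSubtype_apply_of_mem _ hx
  have hout : ∀ x ∉ gball G v n, e x = x := fun x hx =>
    Equiv.Perm.ofSubtype_apply_of_not_mem _ hx
  have hcross : ∀ x ∈ gball G v n, ∀ y ∉ gball G v n, G.Adj x y → G.dist v x = n := by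
    intro x hx y hy hadj
    have h1 : G.dist v x ≤ n := hx
    have h2 : ¬ G.dist v y ≤ n := hy
    have h3 := hconn.dist_triangle (u := v) (v := x) (w := y)
    rw [dist_eq_one_iff_adj.2 hadj] at h3
    omega
  have hmixed : ∀ x ∈ gball G v n, ∀ y ∉ gball G v n, (G.Adj (g x) y ↔ G.Adj x y) := by
    intro x hx y hy
    constructor <;> intro hadj
    · have hd := hcross (g x) ((hinv x).2 hx) y hy hadj
      rw [← hsph x (by rw [← hgv, dist_apply_eq hconn] at hd; exact hd)]
      exact hadj
    · rw [hsph x (hcross x hx y hy hadj)]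
      exact hadj
  refine ⟨⟨e, fun {x y} => ?_⟩, hin, hout⟩
  by_cases hx : x ∈ gball G v n <;> by_cases hy : y ∈ gball G v n
  · rw [hin x hx, hin y hy]
    exact g.map_adj_iff
  · rw [hin x hx, hout y hy]
    exact hmixed x hx y hy
  · rw [hout x hx, hin y hy, G.adj_comm, G.adj_comm x]
    exact hmixed y hy x hx
  · rw [hout x hx, hout y hy]

/-- Let `G` be a connected, locally finite graph with infinite motion,
`v` a vertex and `n ∈ ℕ`. If an automorphism `g` fixes `v` and fixes the sphere
`S_v(n)` pointwise, then it fixes the ball `B_v(n)` pointwise. -/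
theorem stmt_14 {V : Type*} (G : SimpleGraph V) (hconn : G.Connected)
    (hlf : ∀ x : V, (G.neighborSet x).Finite) (hmot : InfiniteMotion G)
    (v : V) (n : ℕ) (g : G ≃g G) (hgv : g v = v)
    (hsph : ∀ x ∈ gsphere G v n, g x = x) :
    ∀ x ∈ gball G v n, g x = x := by
  intro x hx
  obtain ⟨h, hin, hout⟩ := exists_iso_eq_on_gball hconn v n g hgv hsph
  by_contra hne
  refine hmot h ⟨x, by rwa [hin x hx]⟩ ((finite_gball hconn hlf v n).subset fun y hy => ?_)
  by_contra hy'
  exact hy (hout y hy')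
end
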